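/- Let β ∈ (−1, 1/2) with β ≠ −1/2, and set δ = 2β+1. Then, as T → ∞, ∫_{{0 ≤ x ≤ z ≤ T}} e^{x−z} x^β z^β dx dz = −Γ(1+β)²/(2·cos(βπ)) + T^δ/δ − (1/2)·T^{δ−1} + (β(β−1)/(δ−2))·T^{δ−2} − (β(β−2)/2)·T^{δ−3} + O(T^{δ−4}). -/

import Mathlib

open Real MeasureTheory
open Set Filter Topology

/-- The integral of `e ^ x * x ^ β` over `[0, z]`. -/
noncomputable def expRpowIntegral (β z : ℝ) : ℝ := ∫ x in (0 : ℝ)..z, exp x * x ^ β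

/-- The `z`-section of the double integral: the integral of `e ^ (x - z) * x ^ β * z ^ β` over
`x ∈ [0, z]`. -/
noncomputable def sectionIntegral (β z : ℝ) : ℝ := z ^ β * (exp (-z) * expRpowIntegral β z)

theorem intervalIntegrable_exp_mul_rpow {β : ℝ} (hβ : -1 < β) (a b : ℝ) :
    IntervalIntegrable (fun x => exp x * x ^ β) volume a b :=
  (intervalIntegral.intervalIntegrable_rpow' hβ).continuousOn_mul continuous_exp.continuousOn

theorem hasDerivAt_expRpowIntegral {β : ℝ} (hβ : -1 < β) {z : ℝ} (hz : 0 < z) :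
    HasDerivAt (expRpowIntegral β) (exp z * z ^ β) z := by
  refine intervalIntegral.integral_hasDerivAt_right (intervalIntegrable_exp_mul_rpow hβ 0 z)
    (Measurable.stronglyMeasurable (by fun_prop)).stronglyMeasurableAtFilter ?_
  exact continuous_exp.continuousAt.mul (continuousAt_rpow_const _ _ (Or.inl hz.ne'))

theorem expRpowIntegral_nonneg (β : ℝ) {z : ℝ} (hz : 0 ≤ z) : 0 ≤ expRpowIntegral β z :=
  intervalIntegral.integral_nonneg hz fun _ hx => mul_nonneg (exp_pos _).le (rpow_nonneg hx.1 _)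

theorem expRpowIntegral_le {β : ℝ} (hβ : -1 < β) {z : ℝ} (hz : 0 ≤ z) :
    expRpowIntegral β z ≤ exp z * (z ^ (β + 1) / (β + 1)) := by
  have h : expRpowIntegral β z ≤ ∫ x in (0 : ℝ)..z, exp z * x ^ β := by
    refine intervalIntegral.integral_mono_on hz (intervalIntegrable_exp_mul_rpow hβ _ _)
      ((intervalIntegral.intervalIntegrable_rpow' hβ).const_mul _) fun _ hx => ?_
    gcongr
    · exact rpow_nonneg hx.1 _
    · exact hx.2
  rwa [intervalIntegral.integral_const_mul, integral_rpow (Or.inl hβ),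
    zero_rpow (by linarith), sub_zero] at h

theorem sectionIntegral_nonneg (β : ℝ) {z : ℝ} (hz : 0 ≤ z) : 0 ≤ sectionIntegral β z :=
  mul_nonneg (rpow_nonneg hz _) (mul_nonneg (exp_pos _).le (expRpowIntegral_nonneg β hz))

theorem sectionIntegral_le {β : ℝ} (hβ : -1 < β) {z : ℝ} (hz : 0 < z) :
    sectionIntegral β z ≤ z ^ (2 * β + 1) / (β + 1) := by
  calc sectionIntegral β z
      ≤ z ^ β * (exp (-z) * (exp z * (z ^ (β + 1) / (β + 1)))) := by
        unfold sectionIntegral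
        gcongr
        exact expRpowIntegral_le hβ hz.le
    _ = z ^ (2 * β + 1) / (β + 1) := by
        rw [← mul_assoc (exp (-z)), ← exp_add, neg_add_cancel, exp_zero, one_mul,
          mul_div_assoc', ← rpow_add hz]
        ring_nf

theorem continuousOn_sectionIntegral {β : ℝ} (hβ : -1 < β) :
    ContinuousOn (sectionIntegral β) (Ioi 0) := fun z hz =>
  ((continuousAt_rpow_const _ _ (Or.inl (ne_of_gt hz))).mul
    ((by fun_prop : ContinuousAt (fun z : ℝ => exp (-z)) z).mul
      (hasDerivAt_expRpowIntegral hβ hz).continuousAt)).continuousWithinAt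

theorem le_exp_mul_rpow_of_hasDerivAt {E : ℝ → ℝ} {a c : ℝ}
    (hE : ∀ z > 0, HasDerivAt E (c * (exp z * z ^ a)) z) :
    ∃ A, ∀ z ≥ max 1 (2 * |a|), E z ≤ A * (exp z * z ^ a) := by
  set Z := max 1 (2 * |a|)
  have hZ1 : 1 ≤ Z := le_max_left _ _
  have hZa : 2 * |a| ≤ Z := le_max_right _ _
  have hp : ∀ z ≥ Z, 0 < exp z * z ^ a := fun z hz =>
    mul_pos (exp_pos _) (rpow_pos_of_pos (by linarith) _)
  set A := 2 * |c| + |E Z| / (exp Z * Z ^ a) with hA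
  have hAc : 2 * |c| ≤ A := le_add_of_nonneg_right (div_nonneg (abs_nonneg _) (hp Z le_rfl).le)
  have hd : ∀ z ≥ Z, HasDerivAt (fun z => A * (exp z * z ^ a) - E z)
      (A * (exp z * z ^ a + exp z * (a * z ^ (a - 1))) - c * (exp z * z ^ a)) z := fun z hz =>
    (((hasDerivAt_exp z).mul (hasDerivAt_rpow_const (Or.inl (by linarith)))).const_mul A).sub
      (hE z (by linarith))
  refine ⟨A, fun z hz => ?_⟩
  have hmono : MonotoneOn (fun z => A * (exp z * z ^ a) - E z) (Ici Z) := by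
    refine monotoneOn_of_deriv_nonneg (convex_Ici Z)
      (fun z hz => (hd z hz).continuousAt.continuousWithinAt)
      (fun z hz => (hd z (interior_subset hz)).differentiableAt.differentiableWithinAt)
      fun z hz => ?_
    have hz : Z ≤ z := interior_subset hz
    have hz0 : 0 < z := by linarith
    rw [(hd z hz).deriv, rpow_sub_one hz0.ne']
    have hq : -(1 / 2) ≤ a / z := by
      rw [le_div_iff₀ hz0]
      linarith [neg_abs_le a]
    have : 0 ≤ A * (1 + a / z) - c := by
      nlinarith [le_abs_self c, abs_nonneg c]
    calc (0 : ℝ) ≤ (exp z * z ^ a) * (A * (1 + a / z) - c) := mul_nonneg (hp z hz).le this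
      _ = _ := by ring
  have h0 : E Z ≤ A * (exp Z * Z ^ a) := by
    rw [hA, add_mul, div_mul_cancel₀ _ (hp Z le_rfl).ne']
    have := mul_nonneg (abs_nonneg c) (hp Z le_rfl).le
    linarith [le_abs_self (E Z)]
  have := hmono (mem_Ici.2 le_rfl) (mem_Ici.2 hz) hz
  simp only at this
  linarith

theorem abs_sectionIntegral_sub_le {β : ℝ} (hβ : -1 < β) :
    ∃ A Z : ℝ, 1 ≤ Z ∧ ∀ z ≥ Z,
      |sectionIntegral β z - (z ^ (2 * β) - β * z ^ (2 * β - 1) + β * (β - 1) * z ^ (2 * β - 2)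
        - β * (β - 1) * (β - 2) * z ^ (2 * β - 3))| ≤ A * z ^ (2 * β - 4) := by
  set E : ℝ → ℝ := fun z => expRpowIntegral β z - exp z * (z ^ β - β * z ^ (β - 1)
    + β * (β - 1) * z ^ (β - 1 - 1) - β * (β - 1) * (β - 2) * z ^ (β - 1 - 1 - 1)) with hEdef
  have hE : ∀ z > 0, HasDerivAt E
      ((β * (β - 1) * (β - 2) * (β - 3)) * (exp z * z ^ (β - 1 - 1 - 1 - 1))) z := fun z hz => by
    have hr : ∀ r : ℝ, HasDerivAt (fun z : ℝ => z ^ r) (r * z ^ (r - 1)) z := fun r =>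
      hasDerivAt_rpow_const (Or.inl hz.ne')
    refine HasDerivAt.congr_deriv ((hasDerivAt_expRpowIntegral hβ hz).sub ((hasDerivAt_exp z).mul
      ((((hr β).sub ((hr (β - 1)).const_mul β)).add ((hr (β - 1 - 1)).const_mul (β * (β - 1)))).sub
        ((hr (β - 1 - 1 - 1)).const_mul (β * (β - 1) * (β - 2)))))) ?_
    ring
  obtain ⟨A₁, h₁⟩ := le_exp_mul_rpow_of_hasDerivAt hE
  obtain ⟨A₂, h₂⟩ := le_exp_mul_rpow_of_hasDerivAt (E := fun z => -E z)
    (c := -(β * (β - 1) * (β - 2) * (β - 3))) fun z hz => (hE z hz).neg.congr_deriv (by ring)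
  refine ⟨max A₁ A₂, max 1 (2 * |β - 1 - 1 - 1 - 1|), le_max_left _ _, fun z hz => ?_⟩
  have hz0 : 0 < z := lt_of_lt_of_le one_pos ((le_max_left _ _).trans hz)
  have hs : ∀ r, z ^ β * z ^ r = z ^ (β + r) := fun r => (rpow_add hz0 _ _).symm
  have hEz : |E z| ≤ max A₁ A₂ * (exp z * z ^ (β - 1 - 1 - 1 - 1)) := by
    have hp : 0 ≤ exp z * z ^ (β - 1 - 1 - 1 - 1) := by positivity
    exact abs_le'.2 ⟨(h₁ z hz).trans (mul_le_mul_of_nonneg_right (le_max_left _ _) hp),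
      (h₂ z hz).trans (mul_le_mul_of_nonneg_right (le_max_right _ _) hp)⟩
  have hexp : exp (-z) * exp z = 1 := by rw [← exp_add, neg_add_cancel, exp_zero]
  have e0 : z ^ (2 * β) = z ^ β * z ^ β := by rw [hs]; ring_nf
  have e1 : z ^ (2 * β - 1) = z ^ β * z ^ (β - 1) := by rw [hs]; ring_nf
  have e2 : z ^ (2 * β - 2) = z ^ β * z ^ (β - 1 - 1) := by rw [hs]; ring_nf
  have e3 : z ^ (2 * β - 3) = z ^ β * z ^ (β - 1 - 1 - 1) := by rw [hs]; ring_nf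
  have e4 : z ^ (2 * β - 4) = z ^ β * z ^ (β - 1 - 1 - 1 - 1) := by rw [hs]; ring_nf
  have key : sectionIntegral β z - (z ^ (2 * β) - β * z ^ (2 * β - 1)
      + β * (β - 1) * z ^ (2 * β - 2) - β * (β - 1) * (β - 2) * z ^ (2 * β - 3))
      = (z ^ β * exp (-z)) * E z := by
    rw [e0, e1, e2, e3, hEdef, sectionIntegral]
    linear_combination (z ^ β * (z ^ β - β * z ^ (β - 1)
    + β * (β - 1) * z ^ (β - 1 - 1) - β * (β - 1) * (β - 2) * z ^ (β - 1 - 1 - 1))) * hexp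
  rw [key, abs_mul, abs_of_nonneg (by positivity : 0 ≤ z ^ β * exp (-z)), e4]
  calc _ ≤ (z ^ β * exp (-z)) * (max A₁ A₂ * (exp z * z ^ (β - 1 - 1 - 1 - 1))) := by gcongr
    _ = _ := by linear_combination (max A₁ A₂ * (z ^ β * z ^ (β - 1 - 1 - 1 - 1))) * hexp

theorem sectionIntegral_eq_rpow_mul_integral (β : ℝ) {z : ℝ} (hz : 0 < z) :
    sectionIntegral β z
      = z ^ (2 * β + 1) * ∫ u in (0 : ℝ)..1, exp (-((1 - u) * z)) * u ^ β := by
  have h := intervalIntegral.mul_integral_comp_mul_left (a := 0) (b := 1)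
    (f := fun x => exp x * x ^ β) z
  rw [mul_zero, mul_one] at h
  have hpow : z ^ (2 * β + 1) = z ^ β * z ^ β * z := by
    rw [← rpow_add hz, ← rpow_add_one hz.ne']; ring_nf
  rw [sectionIntegral, expRpowIntegral, ← h, hpow, mul_assoc, mul_assoc, mul_left_comm (exp _),
    mul_left_comm (z ^ β) z]
  simp only [← intervalIntegral.integral_const_mul]
  refine intervalIntegral.integral_congr fun u hu => ?_
  rw [uIcc_of_le zero_le_one] at hu
  have : exp (-((1 - u) * z)) = exp (-z) * exp (z * u) := by rw [← exp_add]; ring_nf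
  simp only [mul_rpow hz.le hu.1, this]
  ring

theorem integrableOn_rpow_mul_exp_neg_mul {a r : ℝ} (ha : 0 < a) (hr : 0 < r) :
    IntegrableOn (fun t => t ^ (a - 1) * exp (-(r * t))) (Ioi 0) := by
  refine not_imp_comm.1 integral_undef ?_
  rw [Real.integral_rpow_mul_exp_neg_mul_Ioi ha hr]
  have := Real.Gamma_pos_of_pos ha
  positivity

theorem integrable_mellin_kernel {β : ℝ} (hβ : -1 < β) {w : ℂ} (hw0 : 0 < w.re)
    (hw1 : w.re < 1) :
    Integrable (fun p : ℝ × ℝ =>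
        ((p.1 : ℂ) ^ (w - 1) * Complex.exp (-(((1 - p.2 : ℝ) : ℂ) * p.1))) * (p.2 : ℂ) ^ (β : ℂ))
      ((volume.restrict (Ioi 0)).prod (volume.restrict (Ioo 0 1))) := by
  have hnorm : ∀ u ∈ Ioo (0 : ℝ) 1, ∀ z ∈ Ioi (0 : ℝ),
      ‖((z : ℂ) ^ (w - 1) * Complex.exp (-(((1 - u : ℝ) : ℂ) * z))) * (u : ℂ) ^ (β : ℂ)‖
        = (z ^ (w.re - 1) * exp (-((1 - u) * z))) * u ^ β := fun u hu z hz => by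
    rw [norm_mul, norm_mul, Complex.norm_cpow_eq_rpow_re_of_pos hz,
      Complex.norm_cpow_eq_rpow_re_of_pos hu.1, Complex.norm_exp]
    simp
  rw [integrable_prod_iff' (by
    refine Measurable.aestronglyMeasurable ?_
    fun_prop)]
  constructor
  · filter_upwards [ae_restrict_mem measurableSet_Ioo] with u hu
    have h := (integrableOn_rpow_mul_exp_neg_mul hw0 (sub_pos.2 hu.2)).mul_const (u ^ β)
    refine Integrable.mono' h (Measurable.aestronglyMeasurable (by fun_prop)) ?_
    filter_upwards [ae_restrict_mem measurableSet_Ioi] with z hz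
    exact (hnorm u hu z hz).le
  · have hB := (Complex.betaIntegral_convergent (u := (β + 1 : ℝ)) (v := 1 - w)
      (by rw [Complex.ofReal_re]; linarith)
      (by rw [Complex.sub_re, Complex.one_re]; linarith)).norm
    rw [intervalIntegrable_iff_integrableOn_Ioo_of_le zero_le_one] at hB
    refine (hB.const_mul (Real.Gamma w.re)).congr ?_
    filter_upwards [ae_restrict_mem measurableSet_Ioo] with u hu
    have hu1 : 0 < 1 - u := sub_pos.2 hu.2
    rw [setIntegral_congr_fun measurableSet_Ioi (hnorm u hu), integral_mul_const,
      Real.integral_rpow_mul_exp_neg_mul_Ioi hw0 hu1, norm_mul,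
      Complex.norm_cpow_eq_rpow_re_of_pos hu.1,
      show (1 - (u : ℂ)) = ((1 - u : ℝ) : ℂ) by push_cast; rfl,
      Complex.norm_cpow_eq_rpow_re_of_pos hu1, one_div, inv_rpow hu1.le, ← rpow_neg hu1.le]
    simp
    ring_nf

theorem mellin_sectionIntegral {β : ℝ} (hβ : -1 < β) {s : ℂ} (hs0 : 0 < (s + 2 * β + 1).re)
    (hs1 : (s + 2 * β + 1).re < 1) :
    mellin (fun z => (sectionIntegral β z : ℂ)) s
      = Complex.Gamma (s + 2 * β + 1) * Complex.betaIntegral (β + 1) (1 - (s + 2 * β + 1)) := by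
  set w : ℂ := s + 2 * β + 1 with hw
  have hswap := integral_integral_swap (f := fun z u : ℝ =>
    ((z : ℂ) ^ (w - 1) * Complex.exp (-(((1 - u : ℝ) : ℂ) * z))) * (u : ℂ) ^ (β : ℂ))
    (integrable_mellin_kernel hβ hs0 hs1)
  have hleft : mellin (fun z => (sectionIntegral β z : ℂ)) s = ∫ z in Ioi (0 : ℝ),
      ∫ u in Ioo (0 : ℝ) 1, ((z : ℂ) ^ (w - 1) * Complex.exp (-(((1 - u : ℝ) : ℂ) * z)))
        * (u : ℂ) ^ (β : ℂ) := by
    refine setIntegral_congr_fun measurableSet_Ioi fun z hz => ?_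
    have hz' : (z : ℂ) ≠ 0 := Complex.ofReal_ne_zero.2 (ne_of_gt hz)
    have hpow : (z : ℂ) ^ (w - 1) = (z : ℂ) ^ (s - 1) * ((z ^ (2 * β + 1) : ℝ) : ℂ) := by
      rw [Complex.ofReal_cpow (le_of_lt hz), ← Complex.cpow_add _ _ hz', hw]
      push_cast
      ring_nf
    simp only [mul_assoc, smul_eq_mul]
    rw [integral_const_mul, sectionIntegral_eq_rpow_mul_integral β hz, hpow, mul_assoc,
      Complex.ofReal_mul, ← intervalIntegral.integral_ofReal,
      intervalIntegral.integral_of_le zero_le_one, integral_Ioc_eq_integral_Ioo]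
    congr 2
    refine setIntegral_congr_fun measurableSet_Ioo fun u hu => ?_
    simp [Complex.ofReal_cpow hu.1.le]
  rw [hleft, hswap, Complex.betaIntegral, intervalIntegral.integral_of_le zero_le_one,
    integral_Ioc_eq_integral_Ioo, ← integral_const_mul]
  refine setIntegral_congr_fun measurableSet_Ioo fun u hu => ?_
  have hu1 : 0 < 1 - u := sub_pos.2 hu.2
  rw [integral_mul_const, Complex.integral_cpow_mul_exp_neg_mul_Ioi hs0 hu1, one_div,
    Complex.inv_cpow _ _ (by rw [Complex.arg_ofReal_of_nonneg hu1.le]; exact pi_pos.ne),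
    ← Complex.cpow_neg]
  push_cast
  ring_nf

theorem locallyIntegrableOn_indicator {f : ℝ → ℝ} {s t : Set ℝ} (hf : LocallyIntegrableOn f s)
    (ht : MeasurableSet t) : LocallyIntegrableOn (t.indicator f) s := fun x hx => by
  obtain ⟨u, hu, hfu⟩ := hf x hx
  exact ⟨u, hu, hfu.indicator ht⟩

theorem hasMellin_indicator_Ioi_cpow (a : ℂ) {s : ℂ} (hs : (s + a).re < 0) :
    HasMellin ((Ioi 1).indicator (fun t : ℝ => (t : ℂ) ^ a)) s (-1 / (s + a)) := by
  have hre : (s + a - 1).re < -1 := by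
    rw [Complex.sub_re, Complex.one_re]; linarith
  have hfun : EqOn (fun t : ℝ => (t : ℂ) ^ (s - 1) • (Ioi 1).indicator (fun t : ℝ => (t : ℂ) ^ a) t)
      ((Ioi 1).indicator (fun t : ℝ => (t : ℂ) ^ (s + a - 1))) (Ioi 0) := fun t ht => by
    by_cases h : t ∈ Ioi (1 : ℝ)
    · simp only [indicator_of_mem h, smul_eq_mul]
      rw [← Complex.cpow_add _ _ (Complex.ofReal_ne_zero.2 (ne_of_gt ht))]
      ring_nf
    · simp only [indicator_of_notMem h, smul_zero]
  have hsub : Ioi (0 : ℝ) ∩ Ioi 1 = Ioi 1 :=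
    inter_eq_right.2 (Ioi_subset_Ioi zero_le_one)
  constructor
  · refine IntegrableOn.congr_fun ?_ hfun.symm measurableSet_Ioi
    rw [IntegrableOn, integrable_indicator_iff measurableSet_Ioi, IntegrableOn,
      Measure.restrict_restrict measurableSet_Ioi, inter_comm, hsub]
    exact integrableOn_Ioi_cpow_of_lt hre one_pos
  · rw [mellin, setIntegral_congr_fun measurableSet_Ioi hfun,
      setIntegral_indicator measurableSet_Ioi, hsub, integral_Ioi_cpow_of_lt hre one_pos]
    simp

/-- The section integral minus its two leading terms at infinity, subtracted on `(1, ∞)` only. -/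
noncomputable def regularizedSection (β z : ℝ) : ℝ :=
  sectionIntegral β z - (Ioi 1).indicator (fun z => z ^ (2 * β) - β * z ^ (2 * β - 1)) z

theorem regularizedSection_of_one_lt (β : ℝ) {z : ℝ} (hz : 1 < z) :
    regularizedSection β z = sectionIntegral β z - (z ^ (2 * β) - β * z ^ (2 * β - 1)) := by
  rw [regularizedSection, indicator_of_mem (mem_Ioi.2 hz)]

theorem locallyIntegrableOn_sectionIntegral {β : ℝ} (hβ : -1 < β) :
    LocallyIntegrableOn (sectionIntegral β) (Ioi 0) :=
  (continuousOn_sectionIntegral hβ).locallyIntegrableOn measurableSet_Ioi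

theorem locallyIntegrableOn_regularizedSection {β : ℝ} (hβ : -1 < β) :
    LocallyIntegrableOn (regularizedSection β) (Ioi 0) := by
  refine (locallyIntegrableOn_sectionIntegral hβ).sub
    (locallyIntegrableOn_indicator (ContinuousOn.locallyIntegrableOn ?_ measurableSet_Ioi)
      measurableSet_Ioi)
  have hc : ∀ r : ℝ, ContinuousOn (fun z : ℝ => z ^ r) (Ioi 0) := fun r z hz =>
    (continuousAt_rpow_const _ _ (Or.inl (ne_of_gt hz))).continuousWithinAt
  exact (hc _).sub (continuousOn_const.mul (hc _))

theorem locallyIntegrableOn_ofReal {f : ℝ → ℝ} {s : Set ℝ} (hf : LocallyIntegrableOn f s) :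
    LocallyIntegrableOn (fun z => (f z : ℂ)) s := fun x hx => by
  obtain ⟨u, hu, hfu⟩ := hf x hx
  exact ⟨u, hu, hfu.ofReal⟩

theorem sectionIntegral_isBigO_nhdsGT_zero {β : ℝ} (hβ : -1 < β) :
    sectionIntegral β =O[𝓝[>] 0] fun z : ℝ => z ^ (-(-(2 * β + 1))) := by
  refine Asymptotics.IsBigO.of_bound (β + 1)⁻¹ ?_
  filter_upwards [self_mem_nhdsWithin] with z hz
  rw [norm_of_nonneg (sectionIntegral_nonneg β (le_of_lt hz)),
    norm_of_nonneg (rpow_nonneg (le_of_lt hz) _), neg_neg, inv_mul_eq_div]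
  exact sectionIntegral_le hβ hz

theorem regularizedSection_isBigO_nhdsGT_zero {β : ℝ} (hβ : -1 < β) :
    regularizedSection β =O[𝓝[>] 0] fun z : ℝ => z ^ (-(-(2 * β + 1))) := by
  refine (sectionIntegral_isBigO_nhdsGT_zero hβ).congr' ?_ EventuallyEq.rfl
  filter_upwards [mem_nhdsWithin_of_mem_nhds (Iio_mem_nhds one_pos)] with z hz
  rw [regularizedSection, indicator_of_notMem (notMem_Ioi.2 (le_of_lt hz)), sub_zero]

theorem rpow_isBigO_rpow_atTop {a b : ℝ} (hab : a ≤ b) :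
    (fun z : ℝ => z ^ a) =O[atTop] fun z : ℝ => z ^ b := by
  refine Asymptotics.IsBigO.of_bound 1 ?_
  filter_upwards [eventually_ge_atTop 1] with z hz
  have hz0 : 0 ≤ z := by linarith
  rw [norm_of_nonneg (rpow_nonneg hz0 _), norm_of_nonneg (rpow_nonneg hz0 _), one_mul]
  exact rpow_le_rpow_of_exponent_le hz hab

theorem regularizedSection_isBigO_atTop {β : ℝ} (hβ : -1 < β) :
    regularizedSection β =O[atTop] fun z : ℝ => z ^ (-(2 - 2 * β)) := by
  obtain ⟨A, Z, hZ, h⟩ := abs_sectionIntegral_sub_le hβ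
  have h₁ : (fun z => regularizedSection β z - (β * (β - 1) * z ^ (2 * β - 2)
      - β * (β - 1) * (β - 2) * z ^ (2 * β - 3))) =O[atTop] fun z : ℝ => z ^ (2 * β - 4) := by
    refine Asymptotics.IsBigO.of_bound A ?_
    filter_upwards [eventually_gt_atTop Z] with z hz
    have hz0 : 0 ≤ z := by linarith
    rw [regularizedSection_of_one_lt β (hZ.trans_lt hz), norm_of_nonneg (rpow_nonneg hz0 _),
      norm_eq_abs]
    convert h z hz.le using 2
    ring
  have h₂ := ((rpow_isBigO_rpow_atTop (a := 2 * β - 2) (b := -(2 - 2 * β))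
    (by linarith)).const_mul_left (β * (β - 1))).sub ((rpow_isBigO_rpow_atTop (a := 2 * β - 3) (b := -(2 - 2 * β))
      (by linarith)).const_mul_left (β * (β - 1) * (β - 2)))
  simpa using (h₁.trans (rpow_isBigO_rpow_atTop (b := -(2 - 2 * β)) (by linarith))).add h₂

theorem sectionIntegral_isBigO_atTop {β : ℝ} (hβ : -1 < β) :
    sectionIntegral β =O[atTop] fun z : ℝ => z ^ (-(-(2 * β))) := by
  have h₂ := (rpow_isBigO_rpow_atTop (a := 2 * β) (b := -(-(2 * β))) (by linarith)).sub
    ((rpow_isBigO_rpow_atTop (a := 2 * β - 1) (b := -(-(2 * β))) (by linarith)).const_mul_left β)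
  refine (((regularizedSection_isBigO_atTop hβ).trans
    (rpow_isBigO_rpow_atTop (by linarith))).add h₂).congr' ?_ EventuallyEq.rfl
  filter_upwards [eventually_gt_atTop 1] with z hz
  rw [regularizedSection_of_one_lt β hz]
  ring

theorem ofReal_isBigO {f g : ℝ → ℝ} {l : Filter ℝ} (h : f =O[l] g) :
    (fun z => (f z : ℂ)) =O[l] g :=
  (Asymptotics.isBigO_of_le l fun z => (Complex.norm_real (f z)).le).trans h

theorem mellin_regularizedSection_of_re_lt_one {β : ℝ} (hβ : -1 < β) {s : ℂ}
    (hs0 : 0 < (s + 2 * β + 1).re) (hs1 : (s + 2 * β + 1).re < 1) :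
    mellin (fun z => (regularizedSection β z : ℂ)) s - 1 / (s + 2 * β) + β / (s + 2 * β - 1)
      = Complex.Gamma (s + 2 * β + 1) * Complex.betaIntegral (β + 1) (1 - (s + 2 * β + 1)) := by
  have hre : (s + 2 * β + 1).re = s.re + 2 * β + 1 := by simp
  rw [hre] at hs0 hs1
  have hf : MellinConvergent (fun z => (sectionIntegral β z : ℂ)) s :=
    mellinConvergent_of_isBigO_rpow
      (locallyIntegrableOn_ofReal (locallyIntegrableOn_sectionIntegral hβ))
      (ofReal_isBigO (sectionIntegral_isBigO_atTop hβ)) (by linarith)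
      (ofReal_isBigO (sectionIntegral_isBigO_nhdsGT_zero hβ)) (by linarith)
  have h₁ := hasMellin_indicator_Ioi_cpow (2 * β) (s := s) (by simp; linarith)
  have h₂ := hasMellin_indicator_Ioi_cpow (2 * β - 1) (s := s) (by simp; linarith)
  have h₃ := hasMellin_const_smul h₂.1 (β : ℂ)
  have h₄ := hasMellin_sub h₁.1 h₃.1
  have h₅ := hasMellin_sub hf h₄.1
  have hfun : mellin (fun z => (regularizedSection β z : ℂ)) s
      = mellin (fun t : ℝ => (sectionIntegral β t : ℂ)
        - ((Ioi 1).indicator (fun t : ℝ => (t : ℂ) ^ (2 * β : ℂ)) t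
          - (β : ℂ) • (Ioi 1).indicator (fun t : ℝ => (t : ℂ) ^ (2 * β - 1 : ℂ)) t)) s := by
    refine setIntegral_congr_fun measurableSet_Ioi fun z hz => ?_
    have hz0 : 0 ≤ z := le_of_lt hz
    simp only [regularizedSection]
    by_cases h : z ∈ Ioi (1 : ℝ)
    · simp only [indicator_of_mem h, smul_eq_mul]
      push_cast [Complex.ofReal_cpow hz0]
      ring
    · simp only [indicator_of_notMem h]
      simp
  rw [hfun, h₅.2, h₄.2, h₁.2, h₃.2, h₂.2, mellin_sectionIntegral hβ (hre ▸ hs0) (hre ▸ hs1), smul_eq_mul]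
  ring

theorem differentiableOn_mellin_regularizedSection {β : ℝ} (hβ : -1 < β) :
    DifferentiableOn ℂ (mellin fun z => (regularizedSection β z : ℂ))
      {s | -(2 * β + 1) < s.re ∧ s.re < 2 - 2 * β} := fun _ hs =>
  (mellin_differentiableAt_of_isBigO_rpow
    (locallyIntegrableOn_ofReal (locallyIntegrableOn_regularizedSection hβ))
    (ofReal_isBigO (regularizedSection_isBigO_atTop hβ)) hs.2
    (ofReal_isBigO (regularizedSection_isBigO_nhdsGT_zero hβ)) hs.1).differentiableWithinAt

theorem sin_mul_Gamma_mul_betaIntegral {β : ℝ} (hβ : -1 < β) {w : ℂ} (hw0 : 0 < w.re)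
    (hw1 : w.re < 1) :
    Complex.sin (π * w) * (Complex.Gamma w * Complex.betaIntegral (β + 1) (1 - w))
      = π * Complex.Gamma (β + 1) * (Complex.Gamma (β + 2 - w))⁻¹ := by
  have hre1 : 0 < (1 - w).re := by simpa using hw1
  have hreβ : 0 < (β + 1 : ℂ).re := by simp; linarith
  have hg := Complex.Gamma_mul_Gamma_eq_betaIntegral hreβ hre1
  rw [show (β + 1 + (1 - w) : ℂ) = β + 2 - w by ring] at hg
  have hne : Complex.Gamma (β + 2 - w) ≠ 0 :=
    Complex.Gamma_ne_zero_of_re_pos (by simp; linarith)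
  have hrefl := Complex.Gamma_mul_Gamma_one_sub w
  have hsin : Complex.sin (π * w) ≠ 0 := fun h => by
    rw [h, div_zero] at hrefl
    exact mul_ne_zero (Complex.Gamma_ne_zero_of_re_pos hw0)
      (Complex.Gamma_ne_zero_of_re_pos hre1) hrefl
  rw [eq_div_iff hsin] at hrefl
  rw [eq_mul_inv_iff_mul_eq₀ hne]
  linear_combination (-(Complex.sin (π * w) * Complex.Gamma w)) * hg
    + Complex.Gamma (β + 1) * hrefl

theorem sin_mul_mellin_regularizedSection {β : ℝ} (hβ : -1 < β) {s : ℂ}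
    (hs0 : -(2 * β + 1) < s.re) (hs1 : s.re < 2 - 2 * β) :
    Complex.sin (π * (s + 2 * β + 1)) * ((s + 2 * β) * (s + 2 * β - 1)
        * mellin (fun z => (regularizedSection β z : ℂ)) s
        - (s + 2 * β - 1) + β * (s + 2 * β))
      = (s + 2 * β) * (s + 2 * β - 1)
        * (π * Complex.Gamma (β + 1) * (Complex.Gamma (β + 2 - (s + 2 * β + 1)))⁻¹) := by
  set U : Set ℂ := {s | -(2 * β + 1) < s.re ∧ s.re < 2 - 2 * β}
  have hUopen : IsOpen U := (isOpen_lt continuous_const Complex.continuous_re).inter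
    (isOpen_lt Complex.continuous_re continuous_const)
  have hUconv : Convex ℝ U := (convex_halfSpace_re_gt _).inter (convex_halfSpace_re_lt _)
  have hM := differentiableOn_mellin_regularizedSection hβ
  have hG : Differentiable ℂ fun s : ℂ => (Complex.Gamma (β + 2 - (s + 2 * β + 1)))⁻¹ :=
    Complex.differentiable_one_div_Gamma.comp
      (by fun_prop : Differentiable ℂ fun s : ℂ => (β + 2 - (s + 2 * β + 1) : ℂ))
  have hleft : AnalyticOnNhd ℂ (fun s : ℂ => Complex.sin (π * (s + 2 * β + 1)) *
      ((s + 2 * β) * (s + 2 * β - 1) * mellin (fun z => (regularizedSection β z : ℂ)) s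
        - (s + 2 * β - 1) + β * (s + 2 * β))) U := by
    refine DifferentiableOn.analyticOnNhd ?_ hUopen
    fun_prop
  have hright : AnalyticOnNhd ℂ (fun s : ℂ => (s + 2 * β) * (s + 2 * β - 1)
      * (π * Complex.Gamma (β + 1) * (Complex.Gamma (β + 2 - (s + 2 * β + 1)))⁻¹)) U := by
    refine DifferentiableOn.analyticOnNhd (Differentiable.differentiableOn ?_) hUopen
    fun_prop
  set V : Set ℂ := {s | -(2 * β + 1) < s.re ∧ s.re < -(2 * β)}
  have hVopen : IsOpen V := (isOpen_lt continuous_const Complex.continuous_re).inter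
    (isOpen_lt Complex.continuous_re continuous_const)
  have hs₀ : ((-(2 * β) - 1 / 2 : ℝ) : ℂ) ∈ V := by
    constructor <;> rw [Complex.ofReal_re] <;> linarith
  refine hleft.eqOn_of_preconnected_of_eventuallyEq hright hUconv.isPreconnected
    (z₀ := ((-(2 * β) - 1 / 2 : ℝ) : ℂ)) ⟨hs₀.1, by linarith [hs₀.2]⟩ ?_ ⟨hs0, hs1⟩
  filter_upwards [hVopen.mem_nhds hs₀] with s hs
  have hre : (s + 2 * β + 1).re = s.re + 2 * β + 1 := by simp
  have hw0 : 0 < (s + 2 * β + 1).re := by rw [hre]; linarith [hs.1]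
  have hw1 : (s + 2 * β + 1).re < 1 := by rw [hre]; linarith [hs.2]
  have h₁ : s + 2 * β ≠ 0 := fun h => by
    rw [h] at hw1; simp at hw1
  have h₂ : s + 2 * β - 1 ≠ 0 := fun h => by
    rw [sub_eq_zero.1 h] at hw1; norm_num at hw1
  have h := mellin_regularizedSection_of_re_lt_one hβ hw0 hw1
  have hm : (s + 2 * β) * (s + 2 * β - 1) * mellin (fun z => (regularizedSection β z : ℂ)) s
      - (s + 2 * β - 1) + β * (s + 2 * β) = (s + 2 * β) * (s + 2 * β - 1) *
        (Complex.Gamma (s + 2 * β + 1) * Complex.betaIntegral (β + 1) (1 - (s + 2 * β + 1))) := by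
    rw [← h]
    field_simp
  rw [hm, ← sin_mul_Gamma_mul_betaIntegral hβ hw0 hw1]
  ring

theorem integrableOn_regularizedSection {β : ℝ} (hβ : β ∈ Ioo (-1 : ℝ) (1 / 2)) :
    IntegrableOn (regularizedSection β) (Ioi 0) := by
  have h := mellinConvergent_of_isBigO_rpow (s := 1)
    (locallyIntegrableOn_ofReal (locallyIntegrableOn_regularizedSection hβ.1))
    (ofReal_isBigO (regularizedSection_isBigO_atTop hβ.1))
    (by rw [Complex.one_re]; linarith [hβ.2])
    (ofReal_isBigO (regularizedSection_isBigO_nhdsGT_zero hβ.1))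
    (by rw [Complex.one_re]; linarith [hβ.1])
  have h' : IntegrableOn (fun z => (regularizedSection β z : ℂ)) (Ioi 0) := by
    simpa [MellinConvergent] using h
  exact h'.re

theorem integral_regularizedSection {β : ℝ} (hβ : β ∈ Ioo (-1 : ℝ) (1 / 2)) (h0 : β ≠ 0)
    (h1 : 2 * β + 1 ≠ 0) :
    ∫ z in Ioi 0, regularizedSection β z
      = 1 / (2 * β + 1) - 1 / 2 - Gamma (1 + β) ^ 2 / (2 * cos (β * π)) := by
  have hmellin : mellin (fun z => (regularizedSection β z : ℂ)) 1
      = ((∫ z in Ioi 0, regularizedSection β z : ℝ) : ℂ) := by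
    simp only [mellin, sub_self, Complex.cpow_zero, one_smul]
    exact integral_ofReal
  have h := sin_mul_mellin_regularizedSection hβ.1 (s := 1)
    (by rw [Complex.one_re]; linarith [hβ.1]) (by rw [Complex.one_re]; linarith [hβ.2])
  rw [hmellin] at h
  set J := ∫ z in Ioi 0, regularizedSection β z
  have hreal : sin (π * (1 + 2 * β + 1)) * ((1 + 2 * β) * (1 + 2 * β - 1) * J
      - (1 + 2 * β - 1) + β * (1 + 2 * β))
      = (1 + 2 * β) * (1 + 2 * β - 1)
        * (π * Gamma (β + 1) * (Gamma (β + 2 - (1 + 2 * β + 1)))⁻¹) := by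
    apply Complex.ofReal_injective
    push_cast [← Complex.Gamma_ofReal]
    exact h
  rw [show π * (1 + 2 * β + 1) = 2 * (β * π) + 2 * π by ring, sin_add_two_pi, sin_two_mul,
    show β + 2 - (1 + 2 * β + 1) = -β by ring, add_comm β 1] at hreal
  have hsin : sin (β * π) ≠ 0 := by
    rcases lt_or_gt_of_ne h0 with hneg | hpos
    · exact (sin_neg_of_neg_of_neg_pi_lt (by nlinarith [pi_pos]) (by nlinarith [pi_pos, hβ.1])).ne
    · exact (sin_pos_of_pos_of_lt_pi (by positivity) (by nlinarith [pi_pos, hβ.2])).ne'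
  have hcos : cos (β * π) ≠ 0 := by
    rcases lt_or_gt_of_ne h1 with hneg | hpos
    · rw [← cos_neg]
      exact (cos_neg_of_pi_div_two_lt_of_lt (by nlinarith [pi_pos])
        (by nlinarith [pi_pos, hβ.1])).ne
    · exact (cos_pos_of_mem_Ioo ⟨by nlinarith [pi_pos], by nlinarith [pi_pos, hβ.2]⟩).ne'
  have hrefl := Gamma_mul_Gamma_one_sub (-β)
  rw [sub_neg_eq_add, show π * -β = -(β * π) by ring, sin_neg] at hrefl
  have hGinv : (Gamma (-β))⁻¹ = -(Gamma (1 + β) * sin (β * π) / π) := by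
    have hG : Gamma (1 + β) ≠ 0 := (Gamma_pos_of_pos (by linarith [hβ.1])).ne'
    have : Gamma (-β) = π / -sin (β * π) / Gamma (1 + β) := by rw [← hrefl]; field_simp
    rw [this]
    field_simp
  rw [hGinv, show 1 + 2 * β - 1 = 2 * β by ring, add_comm 1 (2 * β)] at hreal
  have hkey : 2 * β * (2 * β + 1) * sin (β * π) * (2 * cos (β * π)) * J
      = 2 * β * (2 * β + 1) * sin (β * π) * (2 * cos (β * π)) *
        (1 / (2 * β + 1) - 1 / 2 - Gamma (1 + β) ^ 2 / (2 * cos (β * π))) := by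
    field_simp
    field_simp at hreal
    linear_combination hreal
  refine mul_left_cancel₀ ?_ hkey
  positivity

theorem intervalIntegrable_sectionIntegral {β : ℝ} (hβ : -1 < β) {T : ℝ} (hT : 0 ≤ T) :
    IntervalIntegrable (sectionIntegral β) volume 0 T := by
  rw [intervalIntegrable_iff_integrableOn_Ioc_of_le hT]
  have hb := (intervalIntegral.intervalIntegrable_rpow' (a := 0) (b := T)
    (by linarith : -1 < 2 * β + 1)).div_const (β + 1)
  rw [intervalIntegrable_iff_integrableOn_Ioc_of_le hT] at hb
  refine Integrable.mono' hb (((continuousOn_sectionIntegral hβ).mono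
    Ioc_subset_Ioi_self).aestronglyMeasurable measurableSet_Ioc) ?_
  filter_upwards [ae_restrict_mem measurableSet_Ioc] with z hz
  rw [norm_of_nonneg (sectionIntegral_nonneg β hz.1.le)]
  exact sectionIntegral_le hβ hz.1

theorem setIntegral_triangle_eq_integral_sectionIntegral {β : ℝ} (hβ : -1 < β) {T : ℝ}
    (hT : 0 ≤ T) :
    ∫ p : ℝ × ℝ in {p : ℝ × ℝ | 0 ≤ p.1 ∧ p.1 ≤ p.2 ∧ p.2 ≤ T},
        exp (p.1 - p.2) * p.1 ^ β * p.2 ^ β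
      = ∫ z in (0 : ℝ)..T, sectionIntegral β z := by
  set S : Set (ℝ × ℝ) := {p | 0 ≤ p.1 ∧ p.1 ≤ p.2 ∧ p.2 ≤ T}
  set F : ℝ × ℝ → ℝ := fun p => exp (p.1 - p.2) * p.1 ^ β * p.2 ^ β with hF
  have hSm : MeasurableSet S := (measurableSet_le measurable_const measurable_fst).inter
    ((measurableSet_le measurable_fst measurable_snd).inter
      (measurableSet_le measurable_snd measurable_const))
  have hpow : IntegrableOn (fun x : ℝ => x ^ β) (Icc 0 T) := by
    have := intervalIntegral.intervalIntegrable_rpow' (a := 0) (b := T) hβ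
    rwa [intervalIntegrable_iff_integrableOn_Icc_of_le hT] at this
  have hprod : IntegrableOn (fun p : ℝ × ℝ => p.1 ^ β * p.2 ^ β) (Icc 0 T ×ˢ Icc 0 T) := by
    rw [IntegrableOn, Measure.volume_eq_prod, ← Measure.prod_restrict]
    exact hpow.mul_prod hpow
  have hsub : S ⊆ Icc 0 T ×ˢ Icc 0 T := fun p hp =>
    ⟨⟨hp.1, hp.2.1.trans hp.2.2⟩, ⟨hp.1.trans hp.2.1, hp.2.2⟩⟩
  have hFS : IntegrableOn F S := by
    have h := (hprod.mono_set hsub).bdd_mul (c := 1) (f := fun p : ℝ × ℝ => exp (p.1 - p.2))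
      (Measurable.aestronglyMeasurable (by fun_prop)) (by
        filter_upwards [ae_restrict_mem hSm] with p hp
        rw [norm_of_nonneg (exp_pos _).le, exp_le_one_iff]
        linarith [hp.2.1])
    exact h.congr (Eventually.of_forall fun p => (mul_assoc _ _ _).symm)
  change ∫ p in S, F p = _
  rw [← integral_indicator hSm, Measure.volume_eq_prod, integral_prod_symm _
    (by rw [← Measure.volume_eq_prod]; exact (integrable_indicator_iff hSm).2 hFS),
    intervalIntegral.integral_of_le hT, ← integral_Icc_eq_integral_Ioc,
    ← integral_indicator measurableSet_Icc]
  refine integral_congr_ae (Eventually.of_forall fun z => ?_)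
  simp only
  by_cases hz : z ∈ Icc 0 T
  · have hind : ∀ x, S.indicator F (x, z) = (Icc 0 z).indicator (fun x => F (x, z)) x := fun x => by
      by_cases hx : x ∈ Icc 0 z
      · rw [indicator_of_mem hx, indicator_of_mem (show (x, z) ∈ S from ⟨hx.1, hx.2, hz.2⟩)]
      · rw [indicator_of_notMem hx, indicator_of_notMem fun h : (x, z) ∈ S => hx ⟨h.1, h.2.1⟩]
    simp only [hind]
    rw [integral_indicator measurableSet_Icc, indicator_of_mem hz, sectionIntegral,
      expRpowIntegral, intervalIntegral.integral_of_le hz.1, integral_Icc_eq_integral_Ioc,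
      ← integral_const_mul, ← integral_const_mul]
    refine integral_congr_ae (Eventually.of_forall fun x => ?_)
    simp only [hF, sub_eq_add_neg, exp_add]
    ring
  · have hind : ∀ x, S.indicator F (x, z) = 0 := fun x =>
      indicator_of_notMem (fun h : (x, z) ∈ S => hz ⟨h.1.trans h.2.1, h.2.2⟩) _
    simp only [hind, integral_zero, indicator_of_notMem hz]

theorem abs_integral_Ioi_regularizedSection_sub_le {β : ℝ} (hβ : β ∈ Ioo (-1 : ℝ) (1 / 2)) :
    ∃ M c : ℝ, 1 ≤ c ∧ ∀ T > c,
      |(∫ z in Ioi T, regularizedSection β z)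
        - (-(β * (β - 1) / (2 * β - 1)) * T ^ (2 * β - 1) + β * (β - 2) / 2 * T ^ (2 * β - 2))|
        ≤ M * T ^ (2 * β - 3) := by
  obtain ⟨A, Z, hZ, h⟩ := abs_sectionIntegral_sub_le hβ.1
  refine ⟨A / (3 - 2 * β), Z, hZ, fun T hT => ?_⟩
  have hT0 : 0 < T := by linarith
  have hb := hβ.2
  have hq₁ := (integrableOn_Ioi_rpow_of_lt (by linarith : 2 * β - 2 < -1) hT0).const_mul
    (β * (β - 1))
  have hq₂ := (integrableOn_Ioi_rpow_of_lt (by linarith : 2 * β - 3 < -1) hT0).const_mul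
    (β * (β - 1) * (β - 2))
  have hr := (integrableOn_regularizedSection hβ).mono_set (Ioi_subset_Ioi hT0.le)
  have hbound := norm_integral_le_of_norm_le
    ((integrableOn_Ioi_rpow_of_lt (by linarith : 2 * β - 4 < -1) hT0).const_mul A)
    (f := fun z => regularizedSection β z - (β * (β - 1) * z ^ (2 * β - 2)
      - β * (β - 1) * (β - 2) * z ^ (2 * β - 3))) (by
    filter_upwards [ae_restrict_mem measurableSet_Ioi] with z hz
    have hzT : T < z := hz
    rw [regularizedSection_of_one_lt β (by linarith), norm_eq_abs]
    convert h z (by linarith) using 2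
    ring)
  have hd : 2 * β - 1 ≠ 0 := by linarith
  have hd' : β - 1 ≠ 0 := by linarith
  have hd'' : 3 - 2 * β ≠ 0 := by linarith
  have hsub := integral_sub hr (hq₁.sub hq₂)
  simp only [Pi.sub_apply] at hsub
  rw [hsub, integral_sub hq₁ hq₂] at hbound
  simp only [integral_const_mul] at hbound
  rw [integral_Ioi_rpow_of_lt (by linarith) hT0, integral_Ioi_rpow_of_lt (by linarith) hT0,
    integral_Ioi_rpow_of_lt (by linarith) hT0, norm_eq_abs,
    show 2 * β - 2 + 1 = 2 * β - 1 by ring, show 2 * β - 3 + 1 = 2 * (β - 1) by ring,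
    show 2 * β - 4 + 1 = -(3 - 2 * β) by ring] at hbound
  rw [show 2 * β - 2 = 2 * (β - 1) by ring, show 2 * β - 3 = -(3 - 2 * β) by ring]
  convert hbound using 1
  · congr 2
    field_simp
    ring
  · field_simp

theorem integral_sectionIntegral_eq {β : ℝ} (hβ : β ∈ Ioo (-1 : ℝ) (1 / 2)) (h0 : β ≠ 0)
    (h1 : 2 * β + 1 ≠ 0) {T : ℝ} (hT : 1 ≤ T) :
    ∫ z in (0 : ℝ)..T, sectionIntegral β z
      = -Gamma (1 + β) ^ 2 / (2 * cos (β * π)) + T ^ (2 * β + 1) / (2 * β + 1)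
        - 1 / 2 * T ^ (2 * β) - ∫ z in Ioi T, regularizedSection β z := by
  have hT0 : 0 ≤ T := by linarith
  have hr := integrableOn_regularizedSection hβ
  have hr₁ := hr.mono_set (Ioc_subset_Ioi_self : Ioc 0 T ⊆ Ioi 0)
  have hf := intervalIntegrable_sectionIntegral hβ.1 hT0
  rw [intervalIntegrable_iff_integrableOn_Ioc_of_le hT0] at hf
  have hsplit := setIntegral_union (Ioc_disjoint_Ioi le_rfl) measurableSet_Ioi hr₁
    (hr.mono_set (Ioi_subset_Ioi hT0))
  rw [Ioc_union_Ioi_eq_Ioi hT0, integral_regularizedSection hβ h0 h1] at hsplit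
  have hdiff := integral_sub hf hr₁
  have hind : ∀ z, sectionIntegral β z - regularizedSection β z
      = (Ioi 1).indicator (fun z => z ^ (2 * β) - β * z ^ (2 * β - 1)) z := fun z =>
    sub_sub_cancel _ _
  have hmem : (0 : ℝ) ∉ uIcc 1 T := by
    rw [uIcc_of_le hT]; exact fun h => by linarith [h.1]
  have hinter : Ioc 0 T ∩ Ioi 1 = Ioc 1 T := by
    rw [Ioc_inter_Ioi, max_eq_right zero_le_one]
  simp only [hind] at hdiff
  rw [setIntegral_indicator measurableSet_Ioi, hinter,
    ← intervalIntegral.integral_of_le hT, intervalIntegral.integral_sub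
      (intervalIntegral.intervalIntegrable_rpow (Or.inr hmem))
      ((intervalIntegral.intervalIntegrable_rpow (Or.inr hmem)).const_mul β),
    intervalIntegral.integral_const_mul,
    integral_rpow (Or.inr ⟨fun h => h1 (by linarith), hmem⟩),
    integral_rpow (Or.inr ⟨fun h => h0 (by linarith), hmem⟩), one_rpow, one_rpow,
    sub_add_cancel] at hdiff
  rw [intervalIntegral.integral_of_le hT0]
  have hβ2 : β * ((T ^ (2 * β) - 1) / (2 * β)) = 1 / 2 * (T ^ (2 * β) - 1) := by
    field_simp
  rw [hβ2, sub_div] at hdiff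
  rw [neg_div]
  linarith

theorem integral_sectionIntegral_zero (T : ℝ) :
    ∫ z in (0 : ℝ)..T, sectionIntegral 0 z = T - 1 + exp (-T) := by
  have h : ∀ z, sectionIntegral 0 z = 1 - exp (-z) := fun z => by
    simp [sectionIntegral, expRpowIntegral, mul_sub, ← exp_add]
  simp only [h]
  rw [intervalIntegral.integral_sub intervalIntegrable_const
    (Continuous.intervalIntegrable (by fun_prop) _ _)]
  simp
  ring

theorem exp_neg_le_inv_pow_three {T : ℝ} (hT : 0 < T) : exp (-T) ≤ 6 * (T ^ 3)⁻¹ := by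
  have h := pow_div_factorial_le_exp T hT.le 3
  rw [exp_neg, ← div_eq_mul_inv, inv_le_iff_one_le_mul₀ (exp_pos T), div_mul_eq_mul_div,
    one_le_div (by positivity)]
  norm_num [Nat.factorial] at h
  linarith

theorem stmt_15 (β δ : ℝ) (hβ : β ∈ Set.Ioo (-1 : ℝ) (1/2)) (hβ' : β ≠ -1/2)
    (hδ : δ = 2 * β + 1) :
    ∃ M c : ℝ, ∀ T > c,
      |(∫ p : ℝ × ℝ in {p : ℝ × ℝ | 0 ≤ p.1 ∧ p.1 ≤ p.2 ∧ p.2 ≤ T},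
            Real.exp (p.1 - p.2) * p.1 ^ β * p.2 ^ β) -
          (-(Real.Gamma (1 + β)) ^ 2 / (2 * Real.cos (β * π)) + T ^ δ / δ
            - (1/2) * T ^ (δ - 1) + (β * (β - 1) / (δ - 2)) * T ^ (δ - 2)
            - (β * (β - 2) / 2) * T ^ (δ - 3))|
        ≤ M * T ^ (δ - 4) := by
  subst hδ
  rcases eq_or_ne β 0 with rfl | h0
  · refine ⟨6, 0, fun T hT => ?_⟩
    rw [setIntegral_triangle_eq_integral_sectionIntegral hβ.1 hT.le,
      integral_sectionIntegral_zero T]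
    norm_num
    rw [show T - 1 + exp (-T) - (-(1 / 2) + T - 1 / 2) = exp (-T) by ring,
      abs_of_pos (exp_pos _)]
    exact exp_neg_le_inv_pow_three hT
  · have h1 : 2 * β + 1 ≠ 0 := fun h => hβ' (by linarith)
    obtain ⟨M, c, hc, h⟩ := abs_integral_Ioi_regularizedSection_sub_le hβ
    refine ⟨M, c, fun T hT => ?_⟩
    rw [setIntegral_triangle_eq_integral_sectionIntegral hβ.1 (by linarith),
      integral_sectionIntegral_eq hβ h0 h1 (by linarith), ← abs_neg,
      show 2 * β + 1 - 1 = 2 * β by ring, show 2 * β + 1 - 2 = 2 * β - 1 by ring,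
      show 2 * β + 1 - 3 = 2 * β - 2 by ring, show 2 * β + 1 - 4 = 2 * β - 3 by ring]
    convert h T hT using 2
    ring
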